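/- Assume the drift hypothesis holds with strict inequalities, so that q_{i,i−1} > 0 for i = 2,…,M−1. Let t > 0 and let p ≥ 1 be an integer. Then for every intensity vector λ and every j ∈ {1,…,M}: (Ñ_t(λ)^{−p})_{j,M+1} ≤ 1 − ∏_{i=2}^{M−1} (q_{i,i−1}/(1+k̃_i)). In particular there exists a constant c > 0, independent of λ, such that (Ñ_t(λ)^{−p})_{j,M+1} < 1 − c for all λ and all j ∈ {1,…,M}. -/

import Mathlib

noncomputable section

open Finset MeasureTheory

/-- Paper index `j ∈ {1,…,M+1}` as an element of `Fin (M+1)`. -/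
def fid (M j : ℕ) : Fin (M + 1) := ⟨(j - 1) % (M + 1), Nat.mod_lt _ (Nat.succ_pos M)⟩

/-- `q_{j,j+1}` built from the grid `i` and the drift `b`. -/
def qup (i b : ℕ → ℝ) (j : ℕ) : ℝ :=
  ((i j - i (j - 1)) / (i (j + 1) - i (j - 1))) * (1 + (i (j + 1) - i j) * b j)

/-- `q_{j,j-1}` built from the grid `i` and the drift `b`. -/
def qdn (i b : ℕ → ℝ) (j : ℕ) : ℝ :=
  ((i (j + 1) - i j) / (i (j + 1) - i (j - 1))) * (1 - (i j - i (j - 1)) * b j)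

/-- `k̃_j = (i_{j+1}-i_j)(i_j-i_{j-1}) k_j` for `2 ≤ j ≤ M-1`, and `0` otherwise. -/
def ktil (M : ℕ) (i k : ℕ → ℝ) (j : ℕ) : ℝ :=
  if 2 ≤ j ∧ j ≤ M - 1 then (i (j + 1) - i j) * (i j - i (j - 1)) * k j else 0

/-- The drift hypothesis `-1/(i_{j+1}-i_j) < b_j < 1/(i_j - i_{j-1})`. -/
def DriftHyp (M : ℕ) (i b : ℕ → ℝ) : Prop :=
  ∀ j, 2 ≤ j → j ≤ M - 1 →
    -(1 / (i (j + 1) - i j)) < b j ∧ b j < 1 / (i j - i (j - 1))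

/-- An intensity vector: nonnegative on `{2,…,M-1}` and (by convention) `0` elsewhere. -/
def IntensityVec (M : ℕ) (lam : ℕ → ℝ) : Prop :=
  (∀ j, 2 ≤ j → j ≤ M - 1 → 0 ≤ lam j) ∧ (∀ j, ¬(2 ≤ j ∧ j ≤ M - 1) → lam j = 0)

/-- `p ∈ 𝕊^M`. -/
def ProbVec (M : ℕ) (p : ℕ → ℝ) : Prop :=
  (∀ j, 1 ≤ j → j ≤ M → 0 < p j) ∧ ∑ j ∈ Finset.Icc 1 M, p j = 1

/-- `κ` are martingale coordinates for `(i,b)`. -/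
def MartCoord (M : ℕ) (i b κ : ℕ → ℝ) : Prop :=
  (∀ j, 1 ≤ j → j ≤ M - 1 → κ j < κ (j + 1)) ∧
  (∀ j, 2 ≤ j → j ≤ M - 1 →
    qup i b j = (κ j - κ (j - 1)) / (κ (j + 1) - κ (j - 1)) ∧
    qdn i b j = (κ (j + 1) - κ j) / (κ (j + 1) - κ (j - 1)))

/-- The point `x₀` of the G-system. -/
def Gx0 (M : ℕ) (s : ℝ) (κ kt P G : ℕ → ℝ) : ℝ :=
  (∑ j ∈ Finset.Icc 1 M, κ j * P j * (1 + s * G j * kt j)) /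
    (∑ j ∈ Finset.Icc 1 M, P j * (1 + s * G j * kt j))

/-- `(G, l)` solves the G-system with time parameter `s` and probability vector `P`. -/
def GSystem (M : ℕ) (s : ℝ) (κ kt P G : ℕ → ℝ) (l : ℕ) : Prop :=
  2 ≤ l ∧ l ≤ M ∧
  (∀ j, 1 ≤ j → j ≤ M → 0 ≤ G j) ∧ G 1 = 0 ∧ G M = 0 ∧
  κ (l - 1) < Gx0 M s κ kt P G ∧ Gx0 M s κ kt P G ≤ κ l ∧
  (∀ j, 2 ≤ j → j ≤ l - 1 →
    G j = (1 / (s * P j)) *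
      ((κ (j + 1) - κ (j - 1)) / ((κ (j + 1) - κ j) * (κ j - κ (j - 1)))) *
      ∑ a ∈ Finset.Icc 1 (j - 1), (κ j - κ a) * P a * (1 + s * G a * kt a)) ∧
  (∀ j, l ≤ j → j ≤ M - 1 →
    G j = (1 / (s * P j)) *
      ((κ (j + 1) - κ (j - 1)) / ((κ (j + 1) - κ j) * (κ j - κ (j - 1)))) *
      ∑ a ∈ Finset.Icc (j + 1) M, (κ a - κ j) * P a * (1 + s * G a * kt a))

/-- Entry `(j,c)` (paper indices in `{1,…,M+1}`) of the matrix `Ñ_t(λ)`. -/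
def NtE (M : ℕ) (t : ℝ) (i b k lam : ℕ → ℝ) (j c : ℕ) : ℝ :=
  if 2 ≤ j ∧ j ≤ M - 1 then
    if c = j then 1 + t * lam j * (1 + ktil M i k j)
    else if c = j + 1 then -(t * lam j * qup i b j)
    else if c = j - 1 then -(t * lam j * qdn i b j)
    else if c = M + 1 then -(t * lam j * ktil M i k j)
    else 0
  else if c = j then 1 else 0

/-- The `(M+1)×(M+1)` matrix `Ñ_t(λ)`. -/
def Ntilde (M : ℕ) (t : ℝ) (i b k lam : ℕ → ℝ) : Matrix (Fin (M + 1)) (Fin (M + 1)) ℝ :=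
  Matrix.of fun u v => NtE M t i b k lam (u.1 + 1) (v.1 + 1)

/-- The top-left `M×M` block `N_t(λ)` of `Ñ_t(λ)`. -/
def NMat (M : ℕ) (t : ℝ) (i b k lam : ℕ → ℝ) : Matrix (Fin M) (Fin M) ℝ :=
  Matrix.of fun u v => NtE M t i b k lam (u.1 + 1) (v.1 + 1)

/-- Entry `(j,c)` (paper indices) of the one-step transition matrix `P̃^{(h)}(λ)`. -/
def PtE (M : ℕ) (h : ℝ) (i b k lam : ℕ → ℝ) (j c : ℕ) : ℝ :=
  if 2 ≤ j ∧ j ≤ M - 1 then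
    if c = j then 1 - h * lam j * (1 + ktil M i k j)
    else if c = j + 1 then h * lam j * qup i b j
    else if c = j - 1 then h * lam j * qdn i b j
    else if c = M + 1 then h * lam j * ktil M i k j
    else 0
  else if c = j then 1 else 0

/-- The `(M+1)×(M+1)` transition matrix `P̃^{(h)}(λ)`. -/
def Ptilde (M : ℕ) (h : ℝ) (i b k lam : ℕ → ℝ) : Matrix (Fin (M + 1)) (Fin (M + 1)) ℝ :=
  Matrix.of fun u v => PtE M h i b k lam (u.1 + 1) (v.1 + 1)

/-- Entry `(j,c)` (paper indices) of the intensity matrix `Θ(λ)`. -/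
def ThE (M : ℕ) (i b k lam : ℕ → ℝ) (j c : ℕ) : ℝ :=
  if 2 ≤ j ∧ j ≤ M - 1 then
    if c = j then -(lam j * (1 + ktil M i k j))
    else if c = j + 1 then lam j * qup i b j
    else if c = j - 1 then lam j * qdn i b j
    else if c = M + 1 then lam j * ktil M i k j
    else 0
  else 0

/-- The `(M+1)×(M+1)` intensity matrix `Θ(λ)`. -/
def Theta (M : ℕ) (i b k lam : ℕ → ℝ) : Matrix (Fin (M + 1)) (Fin (M + 1)) ℝ :=
  Matrix.of fun u v => ThE M i b k lam (u.1 + 1) (v.1 + 1)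

/-- Minimum principle for a square matrix with nonpositive off-diagonal entries and unit row
sums. -/
lemma nonneg_of_mulVec_nonneg {ι : Type*} [Fintype ι] {A : Matrix ι ι ℝ}
    (hoff : ∀ u v, u ≠ v → A u v ≤ 0) (hrow : ∀ u, ∑ v, A u v = 1)
    {x : ι → ℝ} (hx : ∀ u, 0 ≤ (A.mulVec x) u) (u : ι) : 0 ≤ x u := by
  have : Nonempty ι := ⟨u⟩
  obtain ⟨m, hm⟩ := Finite.exists_min x
  refine le_trans ?_ (hm u)
  have h1 : ∑ v, A m v * (x v - x m) ≤ 0 := by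
    refine Finset.sum_nonpos fun v _ => ?_
    rcases eq_or_ne m v with rfl | hne
    · simp
    · exact mul_nonpos_of_nonpos_of_nonneg (hoff m v hne) (sub_nonneg.2 (hm v))
  have h2 : ∑ v, A m v * (x v - x m) = (A.mulVec x) m - x m := by
    simp only [mul_sub, Finset.sum_sub_distrib, ← Finset.sum_mul, hrow, one_mul]
    rfl
  linarith [hx m]

lemma isUnit_of_unit_row_sum {ι : Type*} [Fintype ι] [DecidableEq ι] {A : Matrix ι ι ℝ}
    (hoff : ∀ u v, u ≠ v → A u v ≤ 0) (hrow : ∀ u, ∑ v, A u v = 1) : IsUnit A := by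
  rw [← Matrix.mulVec_injective_iff_isUnit]
  intro x y hxy
  have hle : ∀ x y : ι → ℝ, A.mulVec x = A.mulVec y → ∀ u, x u ≤ y u := by
    intro x y h u
    have := nonneg_of_mulVec_nonneg hoff hrow (x := y - x)
      (by intro u; simp [Matrix.mulVec_sub, h]) u
    simpa using this
  funext u
  exact le_antisymm (hle x y hxy u) (hle y x hxy.symm u)

/-- A vector dominated by `w`, where `w ≤ A w`, stays dominated by `w` under powers of `A⁻¹`. -/
lemma inv_pow_mulVec_le {ι : Type*} [Fintype ι] [DecidableEq ι] {A : Matrix ι ι ℝ}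
    (hoff : ∀ u v, u ≠ v → A u v ≤ 0) (hrow : ∀ u, ∑ v, A u v = 1)
    {w : ι → ℝ} (hw : ∀ u, w u ≤ (A.mulVec w) u) (p : ℕ) {x : ι → ℝ} (hx : ∀ u, x u ≤ w u)
    (u : ι) : ((A⁻¹ ^ p).mulVec x) u ≤ w u := by
  induction p generalizing u with
  | zero => simpa using hx u
  | succ p ih =>
    have hdet := (Matrix.isUnit_iff_isUnit_det A).1 (isUnit_of_unit_row_sum hoff hrow)
    have h := nonneg_of_mulVec_nonneg hoff hrow (x := w - (A⁻¹ ^ (p + 1)).mulVec x) (by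
      intro v
      rw [Matrix.mulVec_sub, Matrix.mulVec_mulVec, pow_succ', ← mul_assoc,
        Matrix.mul_nonsing_inv A hdet, one_mul]
      exact sub_nonneg.2 ((ih v).trans (hw v))) u
    simpa using h

lemma qup_add_qdn {i b : ℕ → ℝ} {j : ℕ} (h : i (j - 1) < i (j + 1)) :
    qup i b j + qdn i b j = 1 := by
  have : i (j + 1) - i (j - 1) ≠ 0 := (sub_pos.2 h).ne'
  unfold qup qdn
  field_simp
  ring

lemma Ntilde_mulVec_interior {M : ℕ} (t : ℝ) (i b k lam f : ℕ → ℝ) (u : Fin (M + 1))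
    (h2 : 2 ≤ u.1 + 1) (hM : u.1 + 1 ≤ M - 1) :
    ((Ntilde M t i b k lam).mulVec fun v => f (v.1 + 1)) u =
      f (u.1 + 1) + t * lam (u.1 + 1) *
        ((1 + ktil M i k (u.1 + 1)) * f (u.1 + 1) - qup i b (u.1 + 1) * f (u.1 + 2)
          - qdn i b (u.1 + 1) * f u.1 - ktil M i k (u.1 + 1) * f (M + 1)) := by
  obtain ⟨u, hu⟩ := u
  obtain ⟨m, rfl⟩ : ∃ m, u = m + 1 := ⟨u - 1, by simp at h2; omega⟩
  simp only at h2 hM ⊢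
  have key : ∀ x : ℕ, NtE M t i b k lam (m + 1 + 1) (x + 1) * f (x + 1) =
      (if x = m + 1 then (1 + t * lam (m + 1 + 1) * (1 + ktil M i k (m + 1 + 1))) * f (m + 1 + 1)
        else 0) +
      (if x = m + 2 then -(t * lam (m + 1 + 1) * qup i b (m + 1 + 1)) * f (m + 1 + 2) else 0) +
      (if x = m then -(t * lam (m + 1 + 1) * qdn i b (m + 1 + 1)) * f (m + 1) else 0) +
      (if x = M then -(t * lam (m + 1 + 1) * ktil M i k (m + 1 + 1)) * f (M + 1) else 0) := by
    intro x
    rw [NtE, if_pos ⟨h2, hM⟩]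
    by_cases h1 : x = m + 1
    · subst h1
      simp [show m + 1 ≠ M by omega]
    by_cases h2' : x = m + 2
    · subst h2'
      simp [show m + 2 ≠ M by omega]
    by_cases h3 : x = m
    · subst h3
      simp [show x ≠ M by omega]
    by_cases h4 : x = M
    · subst h4
      simp [h1, h2', h3]
    · simp [h1, h2', h3, h4]
  have hsum : ((Ntilde M t i b k lam).mulVec fun v => f (v.1 + 1)) ⟨m + 1, hu⟩ =
      ∑ x ∈ Finset.range (M + 1), NtE M t i b k lam (m + 1 + 1) (x + 1) * f (x + 1) := by
    rw [← Fin.sum_univ_eq_sum_range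
      (fun x => NtE M t i b k lam (m + 1 + 1) (x + 1) * f (x + 1))]
    rfl
  rw [hsum, Finset.sum_congr rfl fun x _ => key x]
  simp only [Finset.sum_add_distrib, Finset.sum_ite_eq', Finset.mem_range]
  rw [if_pos (by omega), if_pos (by omega), if_pos (by omega), if_pos (by omega)]
  ring

lemma Ntilde_mulVec_boundary {M : ℕ} (t : ℝ) (i b k lam : ℕ → ℝ) (x : Fin (M + 1) → ℝ)
    (u : Fin (M + 1)) (h : ¬(2 ≤ u.1 + 1 ∧ u.1 + 1 ≤ M - 1)) :
    ((Ntilde M t i b k lam).mulVec x) u = x u := by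
  have : ∀ v, Ntilde M t i b k lam u v = if v = u then 1 else 0 := by
    intro v
    rw [Ntilde, Matrix.of_apply, NtE, if_neg h]
    simp [Fin.ext_iff]
  simp [Matrix.mulVec, dotProduct, this]

lemma ktil_nonneg {M : ℕ} {i k : ℕ → ℝ} (hi : ∀ j, 1 ≤ j → j ≤ M - 1 → i j < i (j + 1))
    (hk : ∀ j, 2 ≤ j → j ≤ M - 1 → 0 ≤ k j) (j : ℕ) : 0 ≤ ktil M i k j := by
  unfold ktil
  split_ifs with h
  · have h1 := hi j (by omega) h.2
    have h2 := hi (j - 1) (by omega) (by omega)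
    rw [show j - 1 + 1 = j by omega] at h2
    exact mul_nonneg (mul_nonneg (sub_pos.2 h1).le (sub_pos.2 h2).le) (hk j h.1 h.2)
  · exact le_rfl

lemma qup_pos {M : ℕ} {i b : ℕ → ℝ} (hi : ∀ j, 1 ≤ j → j ≤ M - 1 → i j < i (j + 1))
    (hb : DriftHyp M i b) {j : ℕ} (h2 : 2 ≤ j) (hM : j ≤ M - 1) : 0 < qup i b j := by
  have h1 := hi j (by omega) hM
  have h0 := hi (j - 1) (by omega) (by omega)
  rw [show j - 1 + 1 = j by omega] at h0
  have hpos : 0 < i (j + 1) - i j := sub_pos.2 h1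
  refine mul_pos (div_pos (by linarith) (by linarith)) ?_
  have := mul_lt_mul_of_pos_left (hb j h2 hM).1 hpos
  rw [mul_neg, mul_one_div_cancel hpos.ne'] at this
  linarith

/-- Under the (strict) drift hypothesis, so that `q_{i,i-1} > 0` for
`i = 2,…,M-1`, for every intensity vector `λ` and every `j ∈ {1,…,M}` the cemetery entry of
`Ñ_t(λ)^{-p}` satisfies `(Ñ_t(λ)^{-p})_{j,M+1} ≤ 1 - ∏_{i=2}^{M-1} q_{i,i-1}/(1+k̃_i)`;
in particular there is a constant `c > 0`, independent of `λ`, with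
`(Ñ_t(λ)^{-p})_{j,M+1} < 1 - c` for all `λ` and all `j`. -/
theorem stmt_8 (M : ℕ) (hM : 3 ≤ M) (i b k : ℕ → ℝ)
    (hi : ∀ j, 1 ≤ j → j ≤ M - 1 → i j < i (j + 1))
    (hb : DriftHyp M i b)
    (hq : ∀ j, 2 ≤ j → j ≤ M - 1 → 0 < qdn i b j)
    (hk : ∀ j, 2 ≤ j → j ≤ M - 1 → 0 ≤ k j)
    (t : ℝ) (ht : 0 < t) (p : ℕ) (hp : 1 ≤ p) :
    (∀ lam : ℕ → ℝ, IntensityVec M lam → ∀ j, 1 ≤ j → j ≤ M →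
      ((Ntilde M t i b k lam)⁻¹ ^ p) (fid M j) (fid M (M + 1))
        ≤ 1 - ∏ m ∈ Finset.Icc 2 (M - 1), qdn i b m / (1 + ktil M i k m)) ∧
    ∃ c : ℝ, 0 < c ∧
      ∀ lam : ℕ → ℝ, IntensityVec M lam → ∀ j, 1 ≤ j → j ≤ M →
        ((Ntilde M t i b k lam)⁻¹ ^ p) (fid M j) (fid M (M + 1)) < 1 - c := by
  have hkt := ktil_nonneg hi hk
  have hup : ∀ j, 2 ≤ j → j ≤ M - 1 → 0 < qup i b j := fun j => qup_pos hi hb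
  have hone : ∀ j, 2 ≤ j → j ≤ M - 1 → qup i b j + qdn i b j = 1 := by
    intro j h2 h3
    refine qup_add_qdn ?_
    have h1 := hi j (by omega) h3
    have h0 := hi (j - 1) (by omega) (by omega)
    rw [show j - 1 + 1 = j by omega] at h0
    exact h0.trans h1
  set r : ℕ → ℝ := fun m => qdn i b m / (1 + ktil M i k m) with hr
  have hr0 : ∀ m ∈ Finset.Icc 2 (M - 1), 0 < r m := by
    intro m hm
    rw [Finset.mem_Icc] at hm
    exact div_pos (hq m hm.1 hm.2) (by linarith [hkt m])
  have hr1 : ∀ m ∈ Finset.Icc 2 (M - 1), r m ≤ 1 := by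
    intro m hm
    rw [Finset.mem_Icc] at hm
    refine (div_le_one (by linarith [hkt m])).2 ?_
    linarith [hkt m, hup m hm.1 hm.2, hone m hm.1 hm.2]
  set a : ℕ → ℝ := fun n => ∏ m ∈ Finset.Icc 2 (min n (M - 1)), r m with ha
  have hsub : ∀ n, Finset.Icc 2 (min n (M - 1)) ⊆ Finset.Icc 2 (M - 1) := fun n =>
    Finset.Icc_subset_Icc_right (min_le_right _ _)
  have ha0 : ∀ n, 0 < a n := fun n => Finset.prod_pos fun m hm => hr0 m (hsub n hm)
  have ha1 : ∀ n, a n ≤ 1 := fun n =>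
    Finset.prod_le_one (fun m hm => (hr0 m (hsub n hm)).le) fun m hm => hr1 m (hsub n hm)
  have haP : ∀ n, ∏ m ∈ Finset.Icc 2 (M - 1), r m ≤ a n := fun n =>
    Finset.prod_le_prod_of_subset_of_le_one (hsub n) (fun m hm => (hr0 m hm).le)
      fun m hm _ => hr1 m hm
  have hstep : ∀ n, 1 ≤ n → n + 1 ≤ M - 1 →
      (1 + ktil M i k (n + 1)) * a (n + 1) = qdn i b (n + 1) * a n := by
    intro n hn hnM
    have h1 : a (n + 1) = a n * r (n + 1) := by
      simp only [ha]
      rw [min_eq_left hnM, min_eq_left (by omega), Finset.prod_Icc_succ_top (by omega)]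
    have h2 : (1 + ktil M i k (n + 1)) ≠ 0 := by linarith [hkt (n + 1)]
    rw [h1]
    simp only [hr]
    field_simp
  set f : ℕ → ℝ := fun n => if n ≤ M then 1 - a n else 1 with hf
  have main : ∀ lam : ℕ → ℝ, IntensityVec M lam → ∀ j, 1 ≤ j → j ≤ M →
      ((Ntilde M t i b k lam)⁻¹ ^ p) (fid M j) (fid M (M + 1))
        ≤ 1 - ∏ m ∈ Finset.Icc 2 (M - 1), r m := by
    intro lam hlam j hj1 hjM
    have hoff : ∀ u v, u ≠ v → Ntilde M t i b k lam u v ≤ 0 := by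
      intro u v huv
      have hne : v.1 + 1 ≠ u.1 + 1 := fun h => huv (Fin.ext (by omega))
      simp only [Ntilde, Matrix.of_apply, NtE, if_neg hne]
      split_ifs with h
      · have := mul_nonneg ht.le (hlam.1 _ h.1 h.2)
        exact neg_nonpos.2 (mul_nonneg this (hup _ h.1 h.2).le)
      · have := mul_nonneg ht.le (hlam.1 _ h.1 h.2)
        exact neg_nonpos.2 (mul_nonneg this (hq _ h.1 h.2).le)
      · have := mul_nonneg ht.le (hlam.1 _ h.1 h.2)
        exact neg_nonpos.2 (mul_nonneg this (hkt _))
      all_goals exact le_rfl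
    have hrow : ∀ u, ∑ v, Ntilde M t i b k lam u v = 1 := by
      intro u
      have h1 : ∑ v, Ntilde M t i b k lam u v = ((Ntilde M t i b k lam).mulVec fun _ => 1) u := by
        simp [Matrix.mulVec, dotProduct]
      rw [h1]
      by_cases h : 2 ≤ u.1 + 1 ∧ u.1 + 1 ≤ M - 1
      · rw [Ntilde_mulVec_interior t i b k lam (fun _ => 1) u h.1 h.2]
        linear_combination (-(t * lam (u.1 + 1))) * hone _ h.1 h.2
      · rw [Ntilde_mulVec_boundary t i b k lam _ u h]
    have hw : ∀ u : Fin (M + 1), (fun v : Fin (M + 1) => f (v.1 + 1)) u ≤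
        ((Ntilde M t i b k lam).mulVec fun v => f (v.1 + 1)) u := by
      intro u
      by_cases h : 2 ≤ u.1 + 1 ∧ u.1 + 1 ≤ M - 1
      · rw [Ntilde_mulVec_interior t i b k lam f u h.1 h.2]
        refine le_add_of_nonneg_right
          (mul_nonneg (mul_nonneg ht.le (hlam.1 _ h.1 h.2)) ?_)
        simp only [hf]
        rw [if_pos (by omega), if_pos (by omega), if_pos (by omega), if_neg (by omega)]
        have h1 := hstep u.1 (by omega) h.2
        have h2 := mul_pos (hup _ h.1 h.2) (ha0 (u.1 + 2))
        have h3 := hone _ h.1 h.2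
        linarith
      · rw [Ntilde_mulVec_boundary t i b k lam _ u h]
    have hx : ∀ u : Fin (M + 1), (Pi.single (fid M (M + 1)) 1 : Fin (M + 1) → ℝ) u ≤
        f (u.1 + 1) := by
      intro u
      by_cases h : u.1 + 1 ≤ M
      · have hne : u ≠ fid M (M + 1) := by
          intro hu
          have : u.1 = M := by rw [hu]; simp [fid]
          omega
        simp only [Pi.single_eq_of_ne hne, hf, if_pos h]
        linarith [ha1 (u.1 + 1)]
      · have hu : u = fid M (M + 1) := by
          apply Fin.ext
          simp only [fid, Nat.add_sub_cancel, Nat.mod_eq_of_lt (Nat.lt_succ_self M)]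
          omega
        subst hu
        simp only [Pi.single_eq_same, hf, if_neg h, le_refl]
    have hfin := inv_pow_mulVec_le hoff hrow hw p hx (fid M j)
    rw [Matrix.mulVec_single_one] at hfin
    have hj : (fid M j).1 + 1 = j := by
      simp only [fid, Nat.mod_eq_of_lt (show j - 1 < M + 1 by omega)]
      omega
    simp only [hj, hf, if_pos hjM, Matrix.col_apply] at hfin
    linarith [haP j]
  have hP : 0 < ∏ m ∈ Finset.Icc 2 (M - 1), r m := Finset.prod_pos hr0
  refine ⟨main, (∏ m ∈ Finset.Icc 2 (M - 1), r m) / 2, half_pos hP, fun lam hlam j h1 h2 => ?_⟩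
  linarith [main lam hlam j h1 h2]
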